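/- (Kim–Koberda, Lemma 3.1.) For all nonzero integers r, s, t, setting q := ((r : ℝ) + t)/(r*s*t), the matrix M := (B q)^r * A^{-s} * (B q)^t in SL(2,ℝ) satisfies M 1 0 = 0 (its lower-left entry vanishes); i.e. (r+t)/(rst) is a 1-step relation number. -/

import Mathlib

abbrev SL2R := Matrix.SpecialLinearGroup (Fin 2) ℝ

/-- The matrix `A = [[1,1],[0,1]]` in `SL(2,ℝ)`. -/
def A : SL2R := ⟨!![1,1;0,1], by norm_num [Matrix.det_fin_two_of]⟩

/-- The matrix `B q = [[1,0],[q,1]]` in `SL(2,ℝ)`. -/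
def B (q : ℝ) : SL2R := ⟨!![1,0;q,1], by norm_num [Matrix.det_fin_two_of]⟩

theorem coe_A_zpow (n : ℤ) :
    ((A ^ n : SL2R) : Matrix (Fin 2) (Fin 2) ℝ) = !![1, (n : ℝ); 0, 1] := by
  induction n using Int.induction_on with
  | zero => simp [Matrix.one_fin_two]
  | succ n ih =>
    rw [zpow_add_one, Matrix.SpecialLinearGroup.coe_mul, ih]
    simp [A, add_comm]
  | pred n ih =>
    rw [zpow_sub_one, Matrix.SpecialLinearGroup.coe_mul, ih, Matrix.SpecialLinearGroup.coe_inv]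
    simp [A, Matrix.adjugate_fin_two]
    ring

theorem coe_B_zpow (q : ℝ) (n : ℤ) :
    ((B q ^ n : SL2R) : Matrix (Fin 2) (Fin 2) ℝ) = !![1, 0; n * q, 1] := by
  induction n using Int.induction_on with
  | zero => simp [Matrix.one_fin_two]
  | succ n ih =>
    rw [zpow_add_one, Matrix.SpecialLinearGroup.coe_mul, ih]
    simp [B, add_mul]
  | pred n ih =>
    rw [zpow_sub_one, Matrix.SpecialLinearGroup.coe_mul, ih, Matrix.SpecialLinearGroup.coe_inv]
    simp [B, Matrix.adjugate_fin_two]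
    ring

/-- Kim–Koberda, Lemma 3.1: `(r+t)/(rst)` is a 1-step relation number. -/
theorem one_step_relation (r s t : ℤ) (hr : r ≠ 0) (hs : s ≠ 0) (ht : t ≠ 0) :
    ((B (((r : ℝ) + t) / (r * s * t))) ^ r * A ^ (-s) *
      (B (((r : ℝ) + t) / (r * s * t))) ^ t) 1 0 = 0 := by
  have hr' : (r : ℝ) ≠ 0 := Int.cast_ne_zero.mpr hr
  have hs' : (s : ℝ) ≠ 0 := Int.cast_ne_zero.mpr hs
  have ht' : (t : ℝ) ≠ 0 := Int.cast_ne_zero.mpr ht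
  rw [Matrix.SpecialLinearGroup.coe_mul, Matrix.SpecialLinearGroup.coe_mul, coe_A_zpow,
    coe_B_zpow, coe_B_zpow, Matrix.mul_fin_two, Matrix.mul_fin_two]
  simp only [Matrix.of_apply, Matrix.cons_val_zero, Matrix.cons_val_one, Int.cast_neg]
  field_simp
  ring
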